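/- (Corollary 4.) Let c be a positive integer and L ≥ 2. With w = c, the smallest positive integer t satisfying C(t, c) ≥ L satisfies t ≤ ⌈c·L^{1/c}⌉; consequently, Algorithm FastWithRelabeling with w = c completes rendezvous in the exploration model in time at most (4·⌈c·L^{1/c}⌉ + 5)·E and at total cost at most (4c + 2)·E, for any distinct labels ℓ_A, ℓ_B ∈ {1,…,L}, any distinct starting nodes, and any delay τ ≥ 1. -/

import Mathlib

/-- Node reached at the start of phase `k` (phases numbered from 0, each lasting `E` rounds):
in an exploration phase (schedule value `true`) the agent follows `expl` for `E` steps;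
in a waiting phase it stays put. -/
def startOfPhase {V : Type*} (expl : V → ℕ → V) (E : ℕ) (T : ℕ → Bool) (p : V) : ℕ → V
  | 0 => p
  | k + 1 => if T k then expl (startOfPhase expl E T p k) E else startOfPhase expl E T p k

/-- Position at round `t` of an agent with schedule `T`, starting node `p` and wake-up round `τ`:
before waking it sits at `p`; after waking it executes its phases, each lasting `E` rounds. -/
def agentPos {V : Type*} (expl : V → ℕ → V) (E : ℕ) (T : ℕ → Bool) (p : V) (τ t : ℕ) : V :=
  if t < τ then p
  else if T ((t - τ) / E) then expl (startOfPhase expl E T p ((t - τ) / E)) ((t - τ) % E)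
  else startOfPhase expl E T p ((t - τ) / E)

/-- The first round at which the two agents occupy the same node. -/
noncomputable def meetRound {V : Type*} (expl : V → ℕ → V) (E : ℕ) (TA TB : ℕ → Bool) (pA pB : V)
    (τA τB : ℕ) : ℕ :=
  sInf {t | agentPos expl E TA pA τA t = agentPos expl E TB pB τB t}

/-- Cost incurred by an agent by round `t`: the number of rounds up to round `t` that belong to
its exploration phases. -/
def agentCost (E : ℕ) (T : ℕ → Bool) (τ t : ℕ) : ℕ :=
  ((Finset.range (t - τ)).filter fun s => T (s / E) = true).card

/-- The numeric value of a `t`-bit string read most-significant-bit first; lexicographic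
order on `t`-bit strings coincides with the order of these values. -/
def strVal (t : ℕ) (S : Fin t → Bool) : ℕ :=
  ∑ i : Fin t, if S i then 2 ^ (t - 1 - i.val) else 0

/-- The number of 1's in a `t`-bit string (the size of the subset of `{1,…,t}` of which it is
the characteristic string). -/
def strOnes (t : ℕ) (S : Fin t → Bool) : ℕ := (Finset.univ.filter fun i => S i = true).card

/-- `S` is the characteristic string of the lexicographically `ℓ`-th smallest `w`-element
subset of `{1,…,t}`: it has exactly `w` ones, and exactly `ℓ - 1` strings with `w` ones are
lexicographically smaller. -/
def IsNthSmallestString (t w ℓ : ℕ) (S : Fin t → Bool) : Prop :=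
  strOnes t S = w ∧
    ((Finset.univ : Finset (Fin t → Bool)).filter
      fun S' => strOnes t S' = w ∧ strVal t S' < strVal t S).card = ℓ - 1

/-- Algorithm `FastWithRelabeling`: the schedule `T = (1, S₁, S₁, …, S_t, S_t)`; phase `k`
(numbered from 0) is an exploration phase iff the corresponding entry of `T` is 1 (after `T`
is exhausted, the agent waits). -/
def relabelSched (t : ℕ) (S : Fin t → Bool) : ℕ → Bool :=
  fun k => if k = 0 then true
    else if h : (k - 1) / 2 < t then S ⟨(k - 1) / 2, h⟩ else false

/-- At the boundary between phases `k - 1` and `k` the agent is at the starting node of phase `k`. -/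
theorem agentPos_phase_start {V : Type*} {expl : V → ℕ → V} (hexpl0 : ∀ v, expl v 0 = v)
    {E : ℕ} (hE : 1 ≤ E) (T : ℕ → Bool) (p : V) (τ k : ℕ) :
    agentPos expl E T p τ (τ + k * E) = startOfPhase expl E T p k := by
  have hmod : k * E % E = 0 := Nat.mul_mod_left k E
  have hdiv : k * E / E = k := Nat.mul_div_cancel k hE
  simp [agentPos, hmod, hdiv, hexpl0]

theorem agentPos_of_explore {V : Type*} {expl : V → ℕ → V} (hexpl0 : ∀ v, expl v 0 = v)
    {E : ℕ} (hE : 1 ≤ E) {T : ℕ → Bool} {k : ℕ} (hT : T k = true) (p : V) (τ : ℕ)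
    {i : ℕ} (hi : i ≤ E) :
    agentPos expl E T p τ (τ + k * E + i) = expl (startOfPhase expl E T p k) i := by
  rcases hi.lt_or_eq with hi | rfl
  · have hdiv : (k * E + i) / E = k := by
      rw [Nat.add_comm, Nat.add_mul_div_right _ _ hE, Nat.div_eq_of_lt hi, Nat.zero_add]
    have hmod : (k * E + i) % E = i := by
      rw [Nat.add_comm, Nat.add_mul_mod_self_right, Nat.mod_eq_of_lt hi]
    simp [agentPos, Nat.add_assoc, hdiv, hmod, hT]
  · rw [Nat.add_assoc, ← Nat.succ_mul, agentPos_phase_start hexpl0 hE]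
    simp [startOfPhase, hT]

theorem agentPos_of_wait {V : Type*} {expl : V → ℕ → V} (hexpl0 : ∀ v, expl v 0 = v)
    {E : ℕ} (hE : 1 ≤ E) {T : ℕ → Bool} {k : ℕ} (hT : T k = false) (p : V) (τ : ℕ)
    {i : ℕ} (hi : i ≤ E) :
    agentPos expl E T p τ (τ + k * E + i) = startOfPhase expl E T p k := by
  rcases hi.lt_or_eq with hi | rfl
  · have hdiv : (k * E + i) / E = k := by
      rw [Nat.add_comm, Nat.add_mul_div_right _ _ hE, Nat.div_eq_of_lt hi, Nat.zero_add]
    simp [agentPos, Nat.add_assoc, hdiv, hT]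
  · rw [Nat.add_assoc, ← Nat.succ_mul, agentPos_phase_start hexpl0 hE]
    simp [startOfPhase, hT]

/-- Over two consecutive waiting phases the agent does not move. -/
theorem agentPos_of_wait_twice {V : Type*} {expl : V → ℕ → V} (hexpl0 : ∀ v, expl v 0 = v)
    {E : ℕ} (hE : 1 ≤ E) {T : ℕ → Bool} {k : ℕ} (hT : T k = false) (hT' : T (k + 1) = false)
    (p : V) (τ : ℕ) {r : ℕ} (hr : τ + k * E ≤ r) (hr' : r ≤ τ + (k + 2) * E) :
    agentPos expl E T p τ r = startOfPhase expl E T p k := by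
  rcases le_total r (τ + k * E + E) with h | h
  · obtain ⟨i, rfl⟩ := Nat.exists_eq_add_of_le hr
    exact agentPos_of_wait hexpl0 hE hT p τ (by omega)
  · have h2 : τ + (k + 1) * E ≤ r := by rw [Nat.succ_mul]; omega
    obtain ⟨i, rfl⟩ := Nat.exists_eq_add_of_le h2
    rw [agentPos_of_wait hexpl0 hE hT' p τ (by linarith)]
    simp [startOfPhase, hT]

/-- Before waking up, and at its wake-up round, the agent is at its starting node. -/
theorem agentPos_of_le {V : Type*} {expl : V → ℕ → V} (hexpl0 : ∀ v, expl v 0 = v)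
    (E : ℕ) (T : ℕ → Bool) (p : V) {τ r : ℕ} (hr : r ≤ τ) :
    agentPos expl E T p τ r = p := by
  rcases hr.lt_or_eq with h | rfl
  · simp [agentPos, h]
  · simp [agentPos, startOfPhase, hexpl0]

/-- If an agent explores during a phase, it visits the position of an agent that stays put. -/
theorem exists_agentPos_eq_of_explore {V : Type*} {expl : V → ℕ → V}
    (hexpl0 : ∀ v, expl v 0 = v) {E : ℕ} (hE : 1 ≤ E)
    (hexplAll : ∀ v w : V, ∃ i ≤ E, expl v i = w)
    {T : ℕ → Bool} {k : ℕ} (hT : T k = true) (p : V) (τ : ℕ) (f : ℕ → V) (q : V)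
    (hf : ∀ r, τ + k * E ≤ r → r ≤ τ + (k + 1) * E → f r = q) :
    ∃ r ≤ τ + (k + 1) * E, agentPos expl E T p τ r = f r := by
  obtain ⟨i, hi, h⟩ := hexplAll (startOfPhase expl E T p k) q
  have hr : τ + k * E + i ≤ τ + (k + 1) * E := by rw [Nat.succ_mul]; omega
  exact ⟨τ + k * E + i, hr, by
    rw [agentPos_of_explore hexpl0 hE hT p τ hi, h, hf _ (by omega) hr]⟩

theorem relabelSched_odd {t : ℕ} (S : Fin t → Bool) (j : Fin t) :
    relabelSched t S (2 * j + 1) = S j := by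
  have h : 2 * (j : ℕ) / 2 = j := by omega
  simp [relabelSched, h]

theorem relabelSched_even {t : ℕ} (S : Fin t → Bool) (j : Fin t) :
    relabelSched t S (2 * j + 2) = S j := by
  have h : (2 * (j : ℕ) + 1) / 2 = j := by omega
  simp [relabelSched, h]

/-- Agents with different bit strings meet by the end of the schedule of the earlier one. -/
theorem exists_meet_relabelSched {V : Type*} {expl : V → ℕ → V}
    (hexpl0 : ∀ v, expl v 0 = v) {E : ℕ} (hE : 1 ≤ E)
    (hexplAll : ∀ v w : V, ∃ i ≤ E, expl v i = w)
    {t : ℕ} {SA SB : Fin t → Bool} (hS : SA ≠ SB) (pA pB : V) {τ : ℕ} (hτ : 1 ≤ τ) :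
    ∃ r ≤ 1 + (2 * t + 1) * E, agentPos expl E (relabelSched t SA) pA 1 r
        = agentPos expl E (relabelSched t SB) pB τ r := by
  rcases le_or_gt (1 + E) τ with h | h
  · obtain ⟨r, hr, hm⟩ := exists_agentPos_eq_of_explore (k := 0) hexpl0 hE hexplAll
      (T := relabelSched t SA) rfl pA 1 (agentPos expl E (relabelSched t SB) pB τ) pB
      (fun r _ hr => agentPos_of_le hexpl0 E _ pB (by omega))
    exact ⟨r, hr.trans (by gcongr; omega), hm⟩
  · obtain ⟨j, hj⟩ := Function.ne_iff.mp hS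
    have hjt := j.isLt
    cases hA : SA j with
    | true =>
      have hB : SB j = false := by grind
      obtain ⟨r, hr, hm⟩ := exists_agentPos_eq_of_explore (k := 2 * j + 2) hexpl0 hE hexplAll
        ((relabelSched_even SA j).trans hA) pA 1 (agentPos expl E (relabelSched t SB) pB τ) _
        (fun r hr hr' => agentPos_of_wait_twice (k := 2 * j + 1) hexpl0 hE
          ((relabelSched_odd SB j).trans hB) ((relabelSched_even SB j).trans hB) pB τ
          (by linarith) (by linarith))
      exact ⟨r, hr.trans (by gcongr; omega), hm⟩
    | false =>
      have hB : SB j = true := by grind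
      obtain ⟨r, hr, hm⟩ := exists_agentPos_eq_of_explore (k := 2 * j + 1) hexpl0 hE hexplAll
        ((relabelSched_odd SB j).trans hB) pB τ (agentPos expl E (relabelSched t SA) pA 1) _
        (fun r hr hr' => agentPos_of_wait_twice (k := 2 * j + 1) hexpl0 hE
          ((relabelSched_odd SA j).trans hA) ((relabelSched_even SA j).trans hA) pA 1
          (by linarith) (by linarith))
      refine ⟨r, hr.trans ?_, hm.symm⟩
      have h1 : (2 * (j : ℕ) + 3) * E ≤ (2 * t + 1) * E := Nat.mul_le_mul_right E (by omega)
      linarith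

/-- The schedule has an initial exploration phase and two more for each one of the string. -/
theorem exists_relabelSched_phases {t : ℕ} (S : Fin t → Bool) :
    ∃ P : Finset ℕ, P.card ≤ 2 * strOnes t S + 1 ∧ ∀ k, relabelSched t S k = true → k ∈ P := by
  set O := Finset.univ.filter fun i => S i = true with hO
  refine ⟨insert 0 (O.image (fun j : Fin t => 2 * (j : ℕ) + 1) ∪
    O.image (fun j : Fin t => 2 * (j : ℕ) + 2)), ?_, fun k hk => ?_⟩
  · have h1 := Finset.card_image_le (s := O) (f := fun j : Fin t => 2 * (j : ℕ) + 1)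
    have h2 := Finset.card_image_le (s := O) (f := fun j : Fin t => 2 * (j : ℕ) + 2)
    have h3 : strOnes t S = O.card := rfl
    refine (Finset.card_insert_le _ _).trans ?_
    have h4 := Finset.card_union_le (O.image (fun j : Fin t => 2 * (j : ℕ) + 1))
      (O.image (fun j : Fin t => 2 * (j : ℕ) + 2))
    omega
  · rcases Nat.eq_zero_or_pos k with rfl | hpos
    · simp
    · have hlt : (k - 1) / 2 < t := by
        by_contra hge
        simp [relabelSched, hge, hpos.ne'] at hk
      have hSj : S ⟨(k - 1) / 2, hlt⟩ = true := by
        simpa [relabelSched, hlt, hpos.ne'] using hk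
      refine Finset.mem_insert_of_mem (Finset.mem_union.mpr ?_)
      rcases Nat.even_or_odd' k with ⟨m, rfl | rfl⟩
      · refine Or.inr (Finset.mem_image.mpr ⟨⟨(2 * m - 1) / 2, hlt⟩, by simpa [hO] using hSj, ?_⟩)
        simp only
        omega
      · refine Or.inl (Finset.mem_image.mpr
          ⟨⟨(2 * m + 1 - 1) / 2, hlt⟩, by simpa [hO] using hSj, ?_⟩)
        simp only
        omega

theorem agentCost_relabelSched_le {E : ℕ} (hE : 1 ≤ E) {t : ℕ} (S : Fin t → Bool) (τ r : ℕ) :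
    agentCost E (relabelSched t S) τ r ≤ (2 * strOnes t S + 1) * E := by
  obtain ⟨P, hcard, hP⟩ := exists_relabelSched_phases S
  calc agentCost E (relabelSched t S) τ r
      ≤ ((P ×ˢ Finset.range E).image fun x => x.1 * E + x.2).card := by
        refine Finset.card_le_card fun s hs => Finset.mem_image.mpr ⟨(s / E, s % E), ?_, ?_⟩
        · exact Finset.mem_product.mpr
            ⟨hP _ (Finset.mem_filter.mp hs).2, Finset.mem_range.mpr (Nat.mod_lt s hE)⟩
        · exact Nat.div_add_mod' s E
    _ ≤ P.card * E := by
        simpa using Finset.card_image_le (s := P ×ˢ Finset.range E)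
          (f := fun x => x.1 * E + x.2)
    _ ≤ (2 * strOnes t S + 1) * E := Nat.mul_le_mul_right E hcard

/-- The bound `(n / k) ^ k ≤ n.choose k`, without division. -/
theorem pow_le_pow_self_mul_choose {n k : ℕ} (h : k ≤ n) : n ^ k ≤ k ^ k * n.choose k := by
  induction k generalizing n with
  | zero => simp
  | succ k ih =>
    obtain ⟨n, rfl⟩ : ∃ m, n = m + 1 := ⟨n - 1, by omega⟩
    have hkn : k ≤ n := by omega
    have hle : (n + 1) ^ k ≤ (k + 1) ^ k * n.choose k := by
      refine Nat.le_of_mul_le_mul_right ?_ (Nat.pow_self_pos (n := k))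
      calc (n + 1) ^ k * k ^ k = ((n + 1) * k) ^ k := (mul_pow _ _ _).symm
        _ ≤ ((k + 1) * n) ^ k := Nat.pow_le_pow_left (by linarith) k
        _ = (k + 1) ^ k * n ^ k := mul_pow _ _ _
        _ ≤ (k + 1) ^ k * (k ^ k * n.choose k) := Nat.mul_le_mul_left _ (ih hkn)
        _ = (k + 1) ^ k * n.choose k * k ^ k := by ring
    calc (n + 1) ^ (k + 1) = (n + 1) ^ k * (n + 1) := pow_succ _ _
      _ ≤ (k + 1) ^ k * n.choose k * (n + 1) := Nat.mul_le_mul_right _ hle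
      _ = (k + 1) ^ k * ((n + 1) * n.choose k) := by ring
      _ = (k + 1) ^ k * ((n + 1).choose (k + 1) * (k + 1)) := by
        rw [Nat.add_one_mul_choose_eq]
      _ = (k + 1) ^ (k + 1) * (n + 1).choose (k + 1) := by ring

theorem le_choose_ceil_mul_rpow {c L : ℕ} (hc : 0 < c) (hL : 1 ≤ L) :
    c ≤ ⌈(c : ℝ) * (L : ℝ) ^ ((1 : ℝ) / (c : ℝ))⌉₊ ∧
      L ≤ Nat.choose ⌈(c : ℝ) * (L : ℝ) ^ ((1 : ℝ) / (c : ℝ))⌉₊ c := by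
  set x : ℝ := (L : ℝ) ^ ((1 : ℝ) / (c : ℝ)) with hx
  set n := ⌈(c : ℝ) * x⌉₊
  have hx1 : 1 ≤ x := Real.one_le_rpow (by exact_mod_cast hL) (by positivity)
  have hn : (c : ℝ) * x ≤ n := Nat.le_ceil _
  have hcn : c ≤ n := by
    have : (c : ℝ) ≤ n := (le_mul_of_one_le_right (by positivity) hx1).trans hn
    exact_mod_cast this
  have hxc : x ^ c = L := by
    rw [hx, one_div, Real.rpow_inv_natCast_pow (by positivity) hc.ne']
  refine ⟨hcn, Nat.le_of_mul_le_mul_left ?_ (Nat.pow_self_pos (n := c))⟩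
  refine le_trans ?_ (pow_le_pow_self_mul_choose hcn)
  have h : ((c : ℝ) * x) ^ c ≤ (n : ℝ) ^ c := pow_le_pow_left₀ (by positivity) hn c
  rw [mul_pow, hxc] at h
  exact_mod_cast h

/-- Corollary 4: for `w = c` constant, the smallest `t` with `C(t,c) ≥ L` satisfies
`t ≤ ⌈c·L^(1/c)⌉`; consequently Algorithm `FastWithRelabeling` with `w = c` completes
rendezvous in time at most `(4⌈c·L^(1/c)⌉+5)·E` and at total cost at most `(4c+2)·E`. -/
theorem fastWithRelabeling_constant_weight {V : Type*} [Fintype V] [Nonempty V]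
    (E : ℕ) (hE : 1 ≤ E)
    (expl : V → ℕ → V) (hexpl0 : ∀ v, expl v 0 = v)
    (hexplAll : ∀ v w : V, ∃ i ≤ E, expl v i = w)
    (c L t : ℕ) (hc : 0 < c) (hL : 2 ≤ L)
    (ht : 0 < t) (htL : L ≤ Nat.choose t c)
    (htmin : ∀ t', 0 < t' → L ≤ Nat.choose t' c → t ≤ t')
    (ℓA ℓB : ℕ) (hℓA : ℓA ∈ Finset.Icc 1 L) (hℓB : ℓB ∈ Finset.Icc 1 L) (hne : ℓA ≠ ℓB)
    (SA SB : Fin t → Bool)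
    (hSA : IsNthSmallestString t c ℓA SA) (hSB : IsNthSmallestString t c ℓB SB)
    (pA pB : V) (hp : pA ≠ pB) (τ : ℕ) (hτ : 1 ≤ τ) :
    t ≤ ⌈(c : ℝ) * (L : ℝ) ^ ((1 : ℝ) / (c : ℝ))⌉₊ ∧
    (∃ r, agentPos expl E (relabelSched t SA) pA 1 r
        = agentPos expl E (relabelSched t SB) pB τ r) ∧
    meetRound expl E (relabelSched t SA) (relabelSched t SB) pA pB 1 τ
      ≤ (4 * ⌈(c : ℝ) * (L : ℝ) ^ ((1 : ℝ) / (c : ℝ))⌉₊ + 5) * E ∧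
    agentCost E (relabelSched t SA) 1
        (meetRound expl E (relabelSched t SA) (relabelSched t SB) pA pB 1 τ)
      + agentCost E (relabelSched t SB) τ
        (meetRound expl E (relabelSched t SA) (relabelSched t SB) pA pB 1 τ)
      ≤ (4 * c + 2) * E := by
  have hC : t ≤ ⌈(c : ℝ) * (L : ℝ) ^ ((1 : ℝ) / (c : ℝ))⌉₊ := by
    obtain ⟨h1, h2⟩ := le_choose_ceil_mul_rpow hc (L := L) (by omega)
    exact htmin _ (by omega) h2
  have hS : SA ≠ SB := by
    rintro rfl
    have h := hSA.2.symm.trans hSB.2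
    rw [Finset.mem_Icc] at hℓA hℓB
    omega
  obtain ⟨r, hr, hm⟩ := exists_meet_relabelSched hexpl0 hE hexplAll hS pA pB hτ
  refine ⟨hC, ⟨r, hm⟩, ?_, ?_⟩
  · refine (Nat.sInf_le hm).trans (hr.trans ?_)
    calc 1 + (2 * t + 1) * E ≤ E + (2 * t + 1) * E := by gcongr
      _ = (2 * t + 2) * E := by ring
      _ ≤ _ := by gcongr ?_ * E; omega
  · have hA := agentCost_relabelSched_le hE SA 1
      (meetRound expl E (relabelSched t SA) (relabelSched t SB) pA pB 1 τ)
    have hB := agentCost_relabelSched_le hE SB τ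
      (meetRound expl E (relabelSched t SA) (relabelSched t SB) pA pB 1 τ)
    rw [hSA.1] at hA
    rw [hSB.1] at hB
    linarith
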